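/- arXiv:2605.08602 — 6 statements merged into one kernel-verified Lean document; each statement's English description precedes it below -/
import Mathlib

section
/- Let Z be a z-array and x = ψ_∞(Z). Then for every 1 ≤ i ≤ n, σ^{(i)}(x) = max_{1 ≤ j ≤ n+1−i} Σ_{l=1}^{n+2−i−j} ( z(l, i) − z(l−1, i+1) ), where z(0, ·) := 0 and z(l, i+1) := 0 whenever i + 1 > n + 1 − l. -/
namespace PolyReal

/-- Cartan integers `⟨α_s^∨, α_t⟩` of type `A_n`. -/
def coef (s t : ℕ) : ℤ :=
  if s = t then 2 else if s + 1 = t ∨ t + 1 = s then -1 else 0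

/-- Colour of position `k ≥ 1` for the periodic sequence `ι = (…, n, …, 2, 1)`:
position `k = (j-1)n + i` has colour `i`. -/
def col (n k : ℕ) : ℕ := (k - 1) % n + 1

/-- The component `x_j^{(i)} = x_{(j-1)n+i}`, with the conventions
`x_j^{(0)} := 0` and `x_j^{(n+1)} := 0` (indices out of `1 ≤ i ≤ n` give `0`). -/
def Xc (n : ℕ) (x : ℕ → ℤ) (i j : ℕ) : ℤ :=
  if 1 ≤ i ∧ i ≤ n ∧ 1 ≤ j then x ((j - 1) * n + i) else 0

/-- Membership in `Σ_ι`: the chains `x_1^{(i)} ≥ x_2^{(i-1)} ≥ ⋯ ≥ x_i^{(1)} ≥ 0`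
for `1 ≤ i ≤ n`, together with `x_j^{(i)} = 0` for `i + j > n + 1`
(and `x 0 = 0`, since sequences are indexed by positions `k ≥ 1`). -/
def InSigma (n : ℕ) (x : ℕ → ℤ) : Prop :=
  x 0 = 0 ∧
  (∀ i k, 1 ≤ i → i ≤ n → 1 ≤ k → k ≤ i →
    Xc n x (i - k) (k + 1) ≤ Xc n x (i + 1 - k) k) ∧
  (∀ i j, 1 ≤ i → i ≤ n → 1 ≤ j → n + 1 < i + j → Xc n x i j = 0)

/-- Membership in `Σ_ι[λ]`. -/
def InSigmaL (n : ℕ) (lam : ℕ → ℤ) (x : ℕ → ℤ) : Prop :=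
  InSigma n x ∧
  ∀ i j, 1 ≤ j → j ≤ i → i ≤ n →
    Xc n x (i - j + 1) j - Xc n x (i - j) j ≤ lam i - lam (i + 1)

/-- Hypotheses on `λ`: `λ_1 ≥ λ_2 ≥ ⋯ ≥ λ_n (≥ 0)` and `λ_{n+1} = 0`. -/
def IsShape (n : ℕ) (lam : ℕ → ℤ) : Prop :=
  (∀ i, 1 ≤ i → i ≤ n → lam (i + 1) ≤ lam i) ∧ lam (n + 1) = 0

/-- `σ_k(x) = x_k + Σ_{l>k} ⟨α_{i_k}^∨, α_{i_l}⟩ x_l`.  For every sequence occurring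
below the support is contained in positions `≤ n²`, so the sum may be truncated
at `n² + n`. -/
def sig (n : ℕ) (x : ℕ → ℤ) (k : ℕ) : ℤ :=
  x k + ∑ l ∈ Finset.Ioc k (n * n + n), coef (col n k) (col n l) * x l

/-- `σ^{(i)}(x) = max_{k : i_k = i} σ_k(x)`; for the sequences considered here this
maximum is attained among the positions `(j-1)n + i` with `1 ≤ j ≤ n+1`
(`σ` vanishes at all later positions of colour `i`). -/
def sigmaI (n : ℕ) (x : ℕ → ℤ) (i : ℕ) : ℤ :=
  Finset.sup' (Finset.Icc 1 (n + 1)) (Finset.nonempty_Icc.mpr (by omega))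
    (fun j => sig n x ((j - 1) * n + i))

/-- `M^{(i)}(x) = { k : i_k = i, σ_k(x) = σ^{(i)}(x) }`. -/
def Mset (n : ℕ) (x : ℕ → ℤ) (i : ℕ) : Set ℕ :=
  {k | 1 ≤ k ∧ col n k = i ∧ sig n x k = sigmaI n x i}

/-- `σ_0^{(i)}(x) = -(λ_i - λ_{i+1}) + Σ_{l ≥ 1} ⟨α_i^∨, α_{i_l}⟩ x_l`
(again with the sum truncated beyond the support). -/
def sigma0 (n : ℕ) (lam : ℕ → ℤ) (x : ℕ → ℤ) (i : ℕ) : ℤ :=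
  -(lam i - lam (i + 1)) + ∑ l ∈ Finset.Icc 1 (n * n + n), coef i (col n l) * x l

/-- The elementary sequence `e_k`. -/
def eVec (k : ℕ) : ℕ → ℤ := fun l => if l = k then 1 else 0

/-- `Λ_i^{(k)}(x) = x_k^{(i-1)} + λ_{k+i-1}`, set to `0` when `k > n+2-i`. -/
def Lam (n : ℕ) (lam : ℕ → ℤ) (x : ℕ → ℤ) (i k : ℕ) : ℤ :=
  if 1 ≤ k ∧ k ≤ n + 2 - i then Xc n x (i - 1) k + lam (k + i - 1) else 0

/-- A z-array: a family of nonnegative integers indexed by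
`1 ≤ m ≤ n`, `1 ≤ k ≤ n+1-m` (and `0` outside this index range). -/
def IsZArray (n : ℕ) (Z : ℕ → ℕ → ℤ) : Prop :=
  (∀ m k, 1 ≤ m → m ≤ n → 1 ≤ k → k ≤ n + 1 - m → 0 ≤ Z m k) ∧
  (∀ m k, ¬(1 ≤ m ∧ m ≤ n ∧ 1 ≤ k ∧ k ≤ n + 1 - m) → Z m k = 0)

/-- `ψ_∞(Z)`: the sequence with `x_j^{(i)} = Σ_{k=1}^{i} z(n+2-i-j, k)` for
`i + j ≤ n+1` and `x_j^{(i)} = 0` for `i + j > n+1`.  (For a position `p ≥ 1`,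
`i = (p-1) % n + 1` and `j = (p-1)/n + 1`.) -/
def psiInf (n : ℕ) (Z : ℕ → ℕ → ℤ) : ℕ → ℤ := fun p =>
  if p = 0 then 0
  else if (p - 1) % n + 1 + ((p - 1) / n + 1) ≤ n + 1 then
    ∑ k ∈ Finset.Icc 1 ((p - 1) % n + 1),
      Z (n + 2 - ((p - 1) % n + 1) - ((p - 1) / n + 1)) k
  else 0

/-- Reverse semistandard Young tableaux of shape `λ` with entries in `{1, …, n+1}`:
row `j` (for `1 ≤ j ≤ n`) has boxes in columns `1, …, λ_j`; entries are weakly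
decreasing along rows and strictly decreasing down columns; `T` is `0` outside
the diagram. -/
def IsRSSYT (n : ℕ) (lam : ℕ → ℤ) (T : ℕ → ℕ → ℕ) : Prop :=
  (∀ j c : ℕ, 1 ≤ j → j ≤ n → 1 ≤ c → (c : ℤ) ≤ lam j → 1 ≤ T j c ∧ T j c ≤ n + 1) ∧
  (∀ j c : ℕ, 1 ≤ j → j ≤ n → 1 ≤ c → (c : ℤ) + 1 ≤ lam j → T j (c + 1) ≤ T j c) ∧
  (∀ j c : ℕ, 1 ≤ j → j + 1 ≤ n → 1 ≤ c → (c : ℤ) ≤ lam (j + 1) → T (j + 1) c < T j c) ∧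
  (∀ j c : ℕ, ¬(1 ≤ j ∧ j ≤ n ∧ 1 ≤ c ∧ (c : ℤ) ≤ lam j) → T j c = 0)

/-- `Λ_i^{(j)}(T) = #{ c : 1 ≤ c ≤ λ_j, T(j,c) ≥ i }`, as a natural number. -/
def LamTN (lam : ℕ → ℤ) (T : ℕ → ℕ → ℕ) (i j : ℕ) : ℕ :=
  ((Finset.Icc 1 (lam j).toNat).filter (fun c => i ≤ T j c)).card

/-- `Λ_i^{(j)}(T)`, as an integer. -/
def LamT (lam : ℕ → ℤ) (T : ℕ → ℕ → ℕ) (i j : ℕ) : ℤ := (LamTN lam T i j : ℤ)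

/-- The number of boxes of `T` containing the entry `i`. -/
def countEntry (n : ℕ) (lam : ℕ → ℤ) (T : ℕ → ℕ → ℕ) (i : ℕ) : ℤ :=
  ∑ j ∈ Finset.Icc 1 n,
    (((Finset.Icc 1 (lam j).toNat).filter (fun c => T j c = i)).card : ℤ)

/-- Gelfand–Tsetlin patterns of shape `λ`: `g i k` is `y_k^{(i)}`, defined for
`0 ≤ i ≤ n`, `1 ≤ k ≤ n+1-i` (and `0` outside this index range), with
`y_k^{(0)} = λ_k` and the interlacing inequalities. -/
def IsGT (n : ℕ) (lam : ℕ → ℤ) (g : ℕ → ℕ → ℤ) : Prop :=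
  (∀ i k, i ≤ n → 1 ≤ k → k ≤ n + 1 - i → 0 ≤ g i k) ∧
  (∀ k, 1 ≤ k → k ≤ n + 1 → g 0 k = lam k) ∧
  (∀ i k, 1 ≤ i → i ≤ n → 1 ≤ k → k ≤ n + 1 - i →
    g i k ≤ g (i - 1) k ∧ g (i - 1) (k + 1) ≤ g i k) ∧
  (∀ i k, ¬(i ≤ n ∧ 1 ≤ k ∧ k ≤ n + 1 - i) → g i k = 0)

/-- `ς_λ(g)`: the sequence with `x_j^{(i)} = y_j^{(i)} - λ_{i+j}` for
`1 ≤ i ≤ n`, `1 ≤ j ≤ n+1-i`, and `0` otherwise. -/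
def varsig (n : ℕ) (lam : ℕ → ℤ) (g : ℕ → ℕ → ℤ) : ℕ → ℤ := fun p =>
  if p = 0 then 0
  else if (p - 1) % n + 1 + ((p - 1) / n + 1) ≤ n + 1 then
    g ((p - 1) % n + 1) ((p - 1) / n + 1) - lam ((p - 1) % n + 1 + ((p - 1) / n + 1))
  else 0

/-- `σ_j^{(i)}(g) = y_j^{(i)} + 2 Σ_{k=j+1}^{n+1-i} y_k^{(i)} - Σ_{k=j}^{n-i} y_k^{(i+1)}
- Σ_{k=j+1}^{n+2-i} y_k^{(i-1)}`, with the conventions `y_0^{(i)} = 0` and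
out-of-range entries equal to `0`. -/
def sigGT (n : ℕ) (g : ℕ → ℕ → ℤ) (i j : ℕ) : ℤ :=
  (if 1 ≤ j ∧ j ≤ n + 1 - i then g i j else 0)
  + 2 * ∑ k ∈ Finset.Icc (j + 1) (n + 1 - i), g i k
  - ∑ k ∈ Finset.Icc (max j 1) (n - i), g (i + 1) k
  - ∑ k ∈ Finset.Icc (j + 1) (n + 2 - i), g (i - 1) k

/-- The array obtained from `g` by replacing `y_v^{(i)}` with `y_v^{(i)} + d`. -/
def gUpdate (g : ℕ → ℕ → ℤ) (i v : ℕ) (d : ℤ) : ℕ → ℕ → ℤ :=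
  fun i' k => if i' = i ∧ k = v then g i v + d else g i' k

/-- The z-array `Z_g` associated with `g ∈ GT_λ`:
`z(m,k) = y_{n+2-m-k}^{(k)} - y_{n+3-m-k}^{(k-1)}`. -/
def Zg (n : ℕ) (g : ℕ → ℕ → ℤ) (m k : ℕ) : ℤ :=
  if 1 ≤ m ∧ m ≤ n ∧ 1 ≤ k ∧ k ≤ n + 1 - m then
    g k (n + 2 - m - k) - g (k - 1) (n + 3 - m - k)
  else 0

/-- The expression `x_j^{(i)} - x_j^{(i+1)} + 2 Σ_{k=j+1}^{n+1-i} x_k^{(i)}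
- Σ_{k=j+1}^{n+2-i} x_k^{(i-1)} - Σ_{k=j+1}^{n-i} x_k^{(i+1)}`
(with `x^{(0)} = x^{(n+1)} = 0`). -/
def sigExpr (n : ℕ) (x : ℕ → ℤ) (i j : ℕ) : ℤ :=
  Xc n x i j - Xc n x (i + 1) j
  + 2 * ∑ k ∈ Finset.Icc (j + 1) (n + 1 - i), Xc n x i k
  - ∑ k ∈ Finset.Icc (j + 1) (n + 2 - i), Xc n x (i - 1) k
  - ∑ k ∈ Finset.Icc (j + 1) (n - i), Xc n x (i + 1) k

theorem col_eq (n a i : ℕ) (h1 : 1 ≤ i) (h2 : i ≤ n) : col n (a * n + i) = i := by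
  unfold col
  have : a * n + i - 1 = (i - 1) + a * n := by omega
  rw [this, Nat.add_mul_mod_self_right, Nat.mod_eq_of_lt (by omega)]
  omega

theorem psi_eq (n : ℕ) (Z : ℕ → ℕ → ℤ) (hZ : IsZArray n Z) (a i : ℕ) (h1 : 1 ≤ i) (h2 : i ≤ n) :
    psiInf n Z (a * n + i) = ∑ k ∈ Finset.Icc 1 i, Z (n + 1 - i - a) k := by
  unfold psiInf
  have e : a * n + i - 1 = (i - 1) + a * n := by omega
  have e1 : (a * n + i - 1) % n = i - 1 := by
    rw [e, Nat.add_mul_mod_self_right, Nat.mod_eq_of_lt (by omega)]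
  have e2 : (a * n + i - 1) / n = a := by
    rw [e, Nat.add_mul_div_right _ _ (by omega), Nat.div_eq_of_lt (by omega)]
    omega
  rw [e1, e2, if_neg (by omega)]
  have e3 : i - 1 + 1 = i := by omega
  rw [e3]
  split_ifs with h
  · have e4 : n + 2 - i - (a + 1) = n + 1 - i - a := by omega
    rw [e4]
  · symm
    apply Finset.sum_eq_zero
    intro k _
    apply hZ.2
    omega

theorem window (n : ℕ) (x : ℕ → ℤ) (a i : ℕ) (h1 : 1 ≤ i) (h2 : i ≤ n) :
    ∑ l ∈ Finset.Ioc (a * n + i) (a * n + i + n), coef i (col n l) * x l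
      = 2 * x (a * n + i + n) - (if i < n then x (a * n + i + 1) else 0)
        - (if 2 ≤ i then x (a * n + i + n - 1) else 0) := by
  have key : ∀ l ∈ Finset.Ioc (a * n + i) (a * n + i + n), coef i (col n l) * x l
      = (if l = a * n + i + n then 2 * x l else 0)
        - (if l = a * n + i + 1 then (if i < n then x l else 0) else 0)
        - (if l = a * n + i + n - 1 then (if 2 ≤ i then x l else 0) else 0) := by
    intro l hl
    rw [Finset.mem_Ioc] at hl
    obtain ⟨s, rfl⟩ : ∃ s, l = a * n + i + s := ⟨l - (a * n + i), by omega⟩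
    have hc : col n (a * n + i + s) = if i + s ≤ n then i + s else i + s - n := by
      split_ifs with h
      · rw [add_assoc]; exact col_eq n a (i + s) (by omega) h
      · have : a * n + i + s = (a + 1) * n + (i + s - n) := by rw [add_mul]; omega
        rw [this]; exact col_eq n (a + 1) _ (by omega) (by omega)
    rw [hc]
    unfold coef
    split_ifs <;> first | omega | simp
  rw [Finset.sum_congr rfl key, Finset.sum_sub_distrib, Finset.sum_sub_distrib,
    Finset.sum_ite_eq', Finset.sum_ite_eq', Finset.sum_ite_eq']
  simp only [Finset.mem_Ioc]
  split_ifs <;> first | rfl | omega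

theorem sig_eq (n : ℕ) (hn : 1 ≤ n) (Z : ℕ → ℕ → ℤ) (hZ : IsZArray n Z) (i : ℕ)
    (h1 : 1 ≤ i) (h2 : i ≤ n) (d : ℕ) : ∀ a, a + d = n →
    sig n (psiInf n Z) (a * n + i)
      = ∑ l ∈ Finset.Icc 1 (n + 1 - i - a), (Z l i - Z (l - 1) (i + 1)) := by
  have Z0 : ∀ k, Z 0 k = 0 := fun k => hZ.2 0 k (by omega)
  induction d with
  | zero =>
    intro a ha
    obtain rfl : a = n := by omega
    have e : a + 1 - i - a = 0 := by omega
    rw [e]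
    unfold sig
    have hz : ∀ s, 1 ≤ s → s ≤ a → psiInf a Z (a * a + s) = 0 := by
      intro s hs1 hs2
      rw [psi_eq a Z hZ a s hs1 hs2]
      apply Finset.sum_eq_zero
      intro k _
      have : a + 1 - s - a = 0 := by omega
      rw [this, Z0]
    rw [hz i h1 h2, Finset.sum_eq_zero]
    · simp
    · intro l hl
      rw [Finset.mem_Ioc] at hl
      have : l = a * a + (l - a * a) := by omega
      rw [this, hz _ (by omega) (by omega), mul_zero]
  | succ d ih =>
    intro a ha
    have IH := ih (a + 1) (by omega)
    have hk : (a + 1) * n + i = a * n + i + n := by ring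
    have hle : a * n + i + n ≤ n * n + n := by
      have : (a + 1) * n ≤ n * n := Nat.mul_le_mul_right n (by omega)
      rw [add_mul] at this
      omega
    have hsplit := Finset.sum_Ioc_consecutive
      (fun l => coef i (col n l) * psiInf n Z l) (m := a * n + i) (n := a * n + i + n)
      (k := n * n + n) (by omega) hle
    rw [window n _ a i h1 h2] at hsplit
    have hs1 : sig n (psiInf n Z) (a * n + i) = psiInf n Z (a * n + i) +
        ∑ l ∈ Finset.Ioc (a * n + i) (n * n + n), coef i (col n l) * psiInf n Z l := by
      unfold sig; rw [col_eq n a i h1 h2]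
    have hs2 : sig n (psiInf n Z) ((a + 1) * n + i) = psiInf n Z (a * n + i + n) +
        ∑ l ∈ Finset.Ioc (a * n + i + n) (n * n + n), coef i (col n l) * psiInf n Z l := by
      unfold sig; rw [col_eq n (a + 1) i h1 h2, hk]
    have x1 : psiInf n Z (a * n + i) = ∑ k ∈ Finset.Icc 1 i, Z (n + 1 - i - a) k :=
      psi_eq n Z hZ a i h1 h2
    have x2 : psiInf n Z (a * n + i + n) = ∑ k ∈ Finset.Icc 1 i, Z (n + 1 - i - a - 1) k := by
      rw [← hk, psi_eq n Z hZ (a + 1) i h1 h2]; rfl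
    have x3 : (if i < n then psiInf n Z (a * n + i + 1) else 0)
        = ∑ k ∈ Finset.Icc 1 (i + 1), Z (n + 1 - i - a - 1) k := by
      split_ifs with h
      · rw [add_assoc, psi_eq n Z hZ a (i + 1) (by omega) (by omega)]
        have : n + 1 - (i + 1) - a = n + 1 - i - a - 1 := by omega
        rw [this]
      · have : n + 1 - i - a - 1 = 0 := by omega
        rw [this]; simp [Z0]
    have x4 : (if 2 ≤ i then psiInf n Z (a * n + i + n - 1) else 0)
        = ∑ k ∈ Finset.Icc 1 (i - 1), Z (n + 1 - i - a) k := by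
      split_ifs with h
      · have e : a * n + i + n - 1 = (a + 1) * n + (i - 1) := by rw [add_mul]; omega
        rw [e, psi_eq n Z hZ (a + 1) (i - 1) (by omega) (by omega)]
        have : n + 1 - (i - 1) - (a + 1) = n + 1 - i - a := by omega
        rw [this]
      · have : i - 1 = 0 := by omega
        rw [this]; simp
    rw [x3, x4] at hsplit
    have y3 : ∑ k ∈ Finset.Icc 1 (i + 1), Z (n + 1 - i - a - 1) k
        = ∑ k ∈ Finset.Icc 1 i, Z (n + 1 - i - a - 1) k + Z (n + 1 - i - a - 1) (i + 1) :=
      Finset.sum_Icc_succ_top (by omega) _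
    have y1 : ∑ k ∈ Finset.Icc 1 i, Z (n + 1 - i - a) k
        = ∑ k ∈ Finset.Icc 1 (i - 1), Z (n + 1 - i - a) k + Z (n + 1 - i - a) i := by
      obtain ⟨r, rfl⟩ : ∃ r, i = r + 1 := ⟨i - 1, by omega⟩
      exact Finset.sum_Icc_succ_top (by omega) _
    have hr : ∑ l ∈ Finset.Icc 1 (n + 1 - i - a), (Z l i - Z (l - 1) (i + 1))
        = ∑ l ∈ Finset.Icc 1 (n + 1 - i - (a + 1)), (Z l i - Z (l - 1) (i + 1))
          + (Z (n + 1 - i - a) i - Z (n + 1 - i - a - 1) (i + 1)) := by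
      have e : n + 1 - i - (a + 1) = n + 1 - i - a - 1 := by omega
      rw [e]
      rcases Nat.eq_zero_or_pos (n + 1 - i - a) with h | h
      · rw [h]; simp [Z0]
      · obtain ⟨r, hr⟩ : ∃ r, n + 1 - i - a = r + 1 := ⟨n + 1 - i - a - 1, by omega⟩
        rw [hr]
        exact Finset.sum_Icc_succ_top (by omega) _
    linarith

/-- for a z-array `Z` and `x = ψ_∞(Z)`,
`σ^{(i)}(x) = max_{1 ≤ j ≤ n+1-i} Σ_{l=1}^{n+2-i-j} (z(l,i) - z(l-1,i+1))`
(out-of-range values of `Z` are `0` by the definition of a z-array). -/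
theorem stmt2 (n : ℕ) (hn : 1 ≤ n) (Z : ℕ → ℕ → ℤ) (hZ : IsZArray n Z)
    (x : ℕ → ℤ) (hx : x = psiInf n Z) (i : ℕ) (hi1 : 1 ≤ i) (hin : i ≤ n) :
    sigmaI n x i =
      Finset.sup' (Finset.Icc 1 (n + 1 - i)) (Finset.nonempty_Icc.mpr (by omega))
        (fun j => ∑ l ∈ Finset.Icc 1 (n + 2 - i - j), (Z l i - Z (l - 1) (i + 1))) := by
  subst hx
  have F : ∀ j, 1 ≤ j → j ≤ n + 1 → sig n (psiInf n Z) ((j - 1) * n + i)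
      = ∑ l ∈ Finset.Icc 1 (n + 2 - i - j), (Z l i - Z (l - 1) (i + 1)) := by
    intro j hj1 hj2
    rw [sig_eq n hn Z hZ i hi1 hin (n + 1 - j) (j - 1) (by omega)]
    have : n + 1 - i - (j - 1) = n + 2 - i - j := by omega
    rw [this]
  unfold sigmaI
  apply le_antisymm
  · apply Finset.sup'_le
    intro j hj
    rw [Finset.mem_Icc] at hj
    rw [F j hj.1 hj.2]
    by_cases h : j ≤ n + 1 - i
    · exact Finset.le_sup' (fun j => ∑ l ∈ Finset.Icc 1 (n + 2 - i - j),
        (Z l i - Z (l - 1) (i + 1))) (Finset.mem_Icc.mpr ⟨hj.1, h⟩)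
    · have e : n + 2 - i - j = 0 := by omega
      rw [e]
      refine le_trans ?_ (Finset.le_sup' (fun j => ∑ l ∈ Finset.Icc 1 (n + 2 - i - j),
        (Z l i - Z (l - 1) (i + 1))) (Finset.mem_Icc.mpr ⟨?_, le_refl (n + 1 - i)⟩))
      · have e : n + 2 - i - (n + 1 - i) = 1 := by omega
        have h0 := hZ.2 0 (i + 1) (by omega)
        have h1 := hZ.1 1 i le_rfl hn hi1 (by omega)
        simp [e, h0, h1]
      · omega
  · apply Finset.sup'_le
    intro j hj
    rw [Finset.mem_Icc] at hj
    rw [← F j hj.1 (by omega)]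
    exact Finset.le_sup' (fun j => sig n (psiInf n Z) ((j - 1) * n + i))
      (Finset.mem_Icc.mpr ⟨hj.1, by omega⟩)

end PolyReal
end

section
/- For every x ∈ Σ_ι and every 1 ≤ i ≤ n: (a) x + e_{k} ∈ Σ_ι, where k = min M^{(i)}(x); (b) if σ^{(i)}(x) > 0, then x − e_{k'} ∈ Σ_ι, where k' = max M^{(i)}(x). (Here e_k denotes the sequence that is 1 in position k and 0 elsewhere.) -/
namespace PolyReal

theorem aux_dec {n : ℕ} (hn : 1 ≤ n) (k : ℕ) (hk : 1 ≤ k) :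
    ∃ i j, 1 ≤ i ∧ i ≤ n ∧ 1 ≤ j ∧ k = (j - 1) * n + i ∧ col n k = i := by
  refine ⟨(k - 1) % n + 1, (k - 1) / n + 1, by omega, Nat.mod_lt _ hn, Nat.le_add_left _ _, ?_, rfl⟩
  have := Nat.div_add_mod' (k - 1) n
  simp only [Nat.add_sub_cancel]
  omega

theorem aux_col {n : ℕ} (i q : ℕ) (hi : 1 ≤ i) (hin : i ≤ n) : col n (q * n + i) = i := by
  unfold col
  have : q * n + i - 1 = (i - 1) + q * n := by omega
  rw [this, Nat.add_mul_mod_self_right, Nat.mod_eq_of_lt (by omega)]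
  omega

theorem aux_uniq {n : ℕ} (i i' q q' : ℕ) (hi : 1 ≤ i) (hin : i ≤ n) (hi' : 1 ≤ i') (hin' : i' ≤ n)
    (h : q * n + i = q' * n + i') : i = i' ∧ q = q' := by
  have h1 := aux_col i q hi hin
  rw [h, aux_col i' q' hi' hin'] at h1
  subst h1
  refine ⟨rfl, ?_⟩
  have : q * n = q' * n := by omega
  exact Nat.eq_of_mul_eq_mul_right (by omega) this

theorem aux_zero {n : ℕ} (hn : 1 ≤ n) (x : ℕ → ℤ) (hx : InSigma n x) (k : ℕ) (hk : n * n < k) :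
    x k = 0 := by
  obtain ⟨i, j, h1, h2, h3, h4, -⟩ := aux_dec hn k (by omega)
  have hj : n < j := by
    by_contra hj
    have : (j - 1 + 1) * n ≤ n * n := Nat.mul_le_mul_right _ (by omega)
    rw [Nat.add_mul] at this
    omega
  have := hx.2.2 i j h1 h2 h3 (by omega)
  rw [Xc, if_pos ⟨h1, h2, h3⟩] at this
  rw [h4, this]

theorem aux_sig_zero {n : ℕ} (hn : 1 ≤ n) (x : ℕ → ℤ) (hx : InSigma n x) (k : ℕ)
    (hk : n * n < k) : sig n x k = 0 := by
  unfold sig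
  rw [aux_zero hn x hx k hk, Finset.sum_eq_zero, add_zero]
  intro l hl
  rw [Finset.mem_Ioc] at hl
  rw [aux_zero hn x hx l (by omega), mul_zero]

theorem aux_block {n : ℕ} (x : ℕ → ℤ) (i q : ℕ) (hi : 1 ≤ i) (hin : i ≤ n) :
    ∑ l ∈ Finset.Ioc (q * n + i) (q * n + i + n), coef i (col n l) * x l
      = 2 * x (q * n + i + n) - Xc n x (i + 1) (q + 1) - Xc n x (i - 1) (q + 2) := by
  have key : ∀ l ∈ Finset.Ioc (q * n + i) (q * n + i + n), coef i (col n l) * x l =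
      (if l = q * n + i + n then 2 * x (q * n + i + n) else 0)
      + (if l = q * n + i + 1 then (if i + 1 ≤ n then - x (q * n + i + 1) else 0) else 0)
      + (if l = q * n + i + n - 1 then (if 1 < i then - x (q * n + i + n - 1) else 0) else 0) := by
    intro l hl
    rw [Finset.mem_Ioc] at hl
    obtain ⟨t, rfl⟩ : ∃ t, l = q * n + i + t := ⟨l - (q * n + i), by omega⟩
    rcases Nat.lt_or_ge n (i + t) with h | h
    · have hc : col n (q * n + i + t) = i + t - n := by
        have : q * n + i + t = (q + 1) * n + (i + t - n) := by rw [Nat.add_mul]; omega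
        rw [this, aux_col _ _ (by omega) (by omega)]
      rw [hc, coef]
      by_cases h1 : t = n
      · subst h1
        rw [if_pos (by omega), if_pos rfl]
        split_ifs <;> first | omega | simp
      · by_cases h2 : t + 1 = n
        · rw [if_neg (by omega), if_pos (by omega), if_neg (by omega)]
          have : q * n + i + n - 1 = q * n + i + t := by omega
          rw [this]
          split_ifs <;> first | omega | simp
        · rw [if_neg (by omega), if_neg (by omega), if_neg (by omega)]
          split_ifs <;> first | omega | simp
    · have hc : col n (q * n + i + t) = i + t := by
        rw [Nat.add_assoc, aux_col _ _ (by omega) (by omega)]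
      rw [hc, coef]
      by_cases h1 : t = 1
      · subst h1
        rw [if_neg (by omega), if_pos (by omega)]
        split_ifs <;> first | omega | simp
      · rw [if_neg (by omega), if_neg (by omega)]
        split_ifs <;> first | omega | simp
  rw [Finset.sum_congr rfl key, Finset.sum_add_distrib, Finset.sum_add_distrib,
    Finset.sum_ite_eq', Finset.sum_ite_eq', Finset.sum_ite_eq']
  have e1 : Xc n x (i + 1) (q + 1) = if i + 1 ≤ n then x (q * n + i + 1) else 0 := by
    unfold Xc
    simp only [Nat.add_sub_cancel, Nat.add_assoc]
    congr 1
    simp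
  have e2 : Xc n x (i - 1) (q + 2) = if 1 < i then x (q * n + i + n - 1) else 0 := by
    unfold Xc
    by_cases h : 1 < i
    · rw [if_pos (by omega), if_pos h]
      congr 1
      have : (q + 2 - 1) * n = q * n + n := by
        rw [show q + 2 - 1 = q + 1 by omega, Nat.add_mul]; omega
      omega
    · rw [if_neg (by omega), if_neg h]
  rw [e1, e2]
  simp only [Finset.mem_Ioc]
  split_ifs <;> first | omega | ring

theorem aux_rec {n : ℕ} (hn : 1 ≤ n) (x : ℕ → ℤ) (hx : InSigma n x) (i q : ℕ) (hi : 1 ≤ i)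
    (hin : i ≤ n) : sig n x (q * n + i) - sig n x ((q + 1) * n + i) =
      Xc n x i (q + 1) + Xc n x i (q + 2) - Xc n x (i + 1) (q + 1) - Xc n x (i - 1) (q + 2) := by
  have hb := aux_block x i q hi hin
  have hE : (q + 1) * n + i = q * n + i + n := by rw [Nat.add_mul]; omega
  have f1 : Xc n x i (q + 1) = x (q * n + i) := by
    rw [Xc, if_pos (by omega), Nat.add_sub_cancel]
  have f2 : Xc n x i (q + 2) = x (q * n + i + n) := by
    rw [Xc, if_pos (by omega), ← hE]; rfl
  rw [f1, f2, hE]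
  by_cases hq : q + 1 ≤ n
  · have hle : (q + 1) * n ≤ n * n := Nat.mul_le_mul_right _ hq
    unfold sig
    rw [← Finset.sum_Ioc_consecutive _ (show q * n + i ≤ q * n + i + n by omega)
      (show q * n + i + n ≤ n * n + n by omega)]
    rw [aux_col i q hi hin, hb, ← hE, aux_col i (q + 1) hi hin]
    ring
  · have hle : n * n ≤ q * n := Nat.mul_le_mul_right _ (by omega)
    rw [aux_sig_zero hn x hx _ (by omega), aux_sig_zero hn x hx _ (by omega),
      aux_zero hn x hx _ (by omega), aux_zero hn x hx _ (by omega)]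
    have g1 : Xc n x (i + 1) (q + 1) = 0 := by
      by_cases h : i + 1 ≤ n
      · exact hx.2.2 _ _ (by omega) h (by omega) (by omega)
      · rw [Xc, if_neg (by omega)]
    have g2 : Xc n x (i - 1) (q + 2) = 0 := by
      by_cases h : 1 ≤ i - 1
      · exact hx.2.2 _ _ (by omega) (by omega) (by omega) (by omega)
      · rw [Xc, if_neg (by omega)]
    rw [g1, g2]
    ring

theorem aux_le {n : ℕ} (hn : 1 ≤ n) (x : ℕ → ℤ) (hx : InSigma n x) (i q : ℕ) (hi : 1 ≤ i)
    (hin : i ≤ n) : sig n x (q * n + i) ≤ sigmaI n x i := by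
  unfold sigmaI
  by_cases hq : q ≤ n
  · exact Finset.le_sup' (fun j => sig n x ((j - 1) * n + i))
      (Finset.mem_Icc.mpr (⟨by omega, by omega⟩ : 1 ≤ q + 1 ∧ q + 1 ≤ n + 1))
  · have hle : n * n ≤ q * n := Nat.mul_le_mul_right _ (by omega)
    rw [aux_sig_zero hn x hx _ (by omega), ← aux_sig_zero hn x hx (n * n + i) (by omega)]
    exact Finset.le_sup' (fun j => sig n x ((j - 1) * n + i))
      (Finset.mem_Icc.mpr (⟨by omega, by omega⟩ : 1 ≤ n + 1 ∧ n + 1 ≤ n + 1))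

theorem aux_ne {n : ℕ} (x : ℕ → ℤ) (i : ℕ) (hi : 1 ≤ i)
    (hin : i ≤ n) : (Mset n x i).Nonempty := by
  obtain ⟨j, -, h⟩ := Finset.exists_mem_eq_sup' (s := Finset.Icc 1 (n + 1))
    (Finset.nonempty_Icc.mpr (by omega)) (fun j => sig n x ((j - 1) * n + i))
  exact ⟨(j - 1) * n + i, by omega, aux_col _ _ hi hin, h.symm⟩

/-- The chain inequalities hold for all indices. -/
theorem aux_chain {n : ℕ} (x : ℕ → ℤ) (hx : InSigma n x) (i j : ℕ) (hi : 1 ≤ i)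
    (hj : 1 ≤ j) : Xc n x (i - 1) (j + 1) ≤ Xc n x i j := by
  by_cases h : i + j ≤ n + 1
  · have := hx.2.1 (i + j - 1) j (by omega) (by omega) hj (by omega)
    rwa [show i + j - 1 - j = i - 1 by omega, show i + j - 1 + 1 - j = i by omega] at this
  · have g1 : Xc n x i j = 0 := by
      by_cases h : i ≤ n
      · exact hx.2.2 _ _ (by omega) h (by omega) (by omega)
      · rw [Xc, if_neg (by omega)]
    have g2 : Xc n x (i - 1) (j + 1) = 0 := by
      by_cases h : 1 ≤ i - 1 ∧ i - 1 ≤ n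
      · exact hx.2.2 _ _ (by omega) (by omega) (by omega) (by omega)
      · rw [Xc, if_neg (by omega)]
    rw [g1, g2]

theorem aux_Xzero {n : ℕ} (x : ℕ → ℤ) (hx : InSigma n x) (i j : ℕ)
    (h : n + 1 < i + j) : Xc n x i j = 0 := by
  by_cases h' : 1 ≤ i ∧ i ≤ n ∧ 1 ≤ j
  · exact hx.2.2 _ _ h'.1 h'.2.1 h'.2.2 h
  · rw [Xc, if_neg h']

theorem aux_upd {n : ℕ} (x y : ℕ → ℤ) (c : ℤ) (hx : InSigma n x) (i q : ℕ) (hi : 1 ≤ i)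
    (hin : i ≤ n) (hq : i + q ≤ n) (hy : ∀ l, y l = x l + c * eVec (q * n + i) l)
    (h1 : Xc n x (i - 1) (q + 2) ≤ Xc n x i (q + 1) + c)
    (h2 : 1 ≤ q → Xc n x i (q + 1) + c ≤ Xc n x (i + 1) q) : InSigma n y := by
  have hX : ∀ a b, Xc n y a b = Xc n x a b + if a = i ∧ b = q + 1 then c else 0 := by
    intro a b
    unfold Xc
    by_cases h : 1 ≤ a ∧ a ≤ n ∧ 1 ≤ b
    · rw [if_pos h, if_pos h, hy, eVec]
      by_cases h' : a = i ∧ b = q + 1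
      · obtain ⟨rfl, rfl⟩ := h'
        simp
      · rw [if_neg h', if_neg]
        · ring
        · intro he
          have := aux_uniq a i (b - 1) q h.1 h.2.1 hi hin he
          omega
    · rw [if_neg h, if_neg h, if_neg (by omega)]; rfl
  refine ⟨?_, ?_, ?_⟩
  · rw [hy, hx.1, eVec, if_neg (by omega)]; ring
  · intro a k ha han hk hka
    have := hx.2.1 a k ha han hk hka
    rw [hX, hX]
    by_cases e1 : a - k = i ∧ k + 1 = q + 1
    · obtain ⟨e1, e2⟩ := e1
      obtain rfl : k = q := by omega
      rw [if_pos (by omega), if_neg (by omega), e1, show a + 1 - k = i + 1 by omega]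
      linarith [h2 hk]
    · rw [if_neg e1]
      by_cases e2 : a + 1 - k = i ∧ k = q + 1
      · obtain ⟨e2, rfl⟩ := e2
        rw [if_pos (by omega), e2, show a - (q + 1) = i - 1 by omega]
        linarith
      · rw [if_neg e2]
        linarith
  · intro a b ha han hb hab
    rw [hX, hx.2.2 a b ha han hb hab, if_neg (by omega)]
    rfl

/-- for `x ∈ Σ_ι` and `1 ≤ i ≤ n`: (a) `x + e_{min M^{(i)}(x)} ∈ Σ_ι`;
(b) if `σ^{(i)}(x) > 0` then `x - e_{max M^{(i)}(x)} ∈ Σ_ι`. -/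
theorem stmt3 (n : ℕ) (hn : 1 ≤ n) (x : ℕ → ℤ) (hx : InSigma n x)
    (i : ℕ) (hi1 : 1 ≤ i) (hin : i ≤ n) :
    InSigma n (fun l => x l + eVec (sInf (Mset n x i)) l) ∧
    (0 < sigmaI n x i → InSigma n (fun l => x l - eVec (sSup (Mset n x i)) l)) := by
  have hne := aux_ne x i hi1 hin
  constructor
  · obtain ⟨m1, m2, m3⟩ := Nat.sInf_mem hne
    have hmin : ∀ k ∈ Mset n x i, sInf (Mset n x i) ≤ k := fun k hk => Nat.sInf_le hk
    generalize sInf (Mset n x i) = k at *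
    obtain ⟨i', j, d1, d2, d3, rfl, d5⟩ := aux_dec hn k m1
    obtain rfl : i' = i := by rw [← d5, m2]
    obtain ⟨q, rfl⟩ : ∃ q, j = q + 1 := ⟨j - 1, by omega⟩
    rw [Nat.add_sub_cancel] at *
    have hch := aux_chain x hx i' (q + 1) hi1 (by omega)
    have hq : 1 ≤ q → Xc n x i' (q + 1) + 1 ≤ Xc n x (i' + 1) q := by
      intro hq
      obtain ⟨p, rfl⟩ : ∃ p, q = p + 1 := ⟨q - 1, by omega⟩
      have hlt : sig n x (p * n + i') < sig n x ((p + 1) * n + i') := by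
        rw [m3]
        refine lt_of_le_of_ne (aux_le hn x hx i' p hi1 hin) (fun he => ?_)
        have := hmin _ ⟨by omega, aux_col _ _ hi1 hin, he⟩
        rw [Nat.add_mul] at this
        omega
      have hr := aux_rec hn x hx i' p hi1 hin
      have hc := aux_chain x hx i' (p + 1) hi1 (by omega)
      linarith
    refine aux_upd x _ 1 hx i' q hi1 hin ?_ (fun l => by ring) (by linarith) hq
    by_contra hcon
    have := hq (by omega)
    rw [aux_Xzero x hx i' (q + 1) (by omega), aux_Xzero x hx (i' + 1) q (by omega)] at this
    omega
  · intro hpos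
    have hbdd : BddAbove (Mset n x i) := by
      refine ⟨n * n, fun k hk => ?_⟩
      by_contra hcon
      have := hk.2.2
      rw [aux_sig_zero hn x hx k (by omega)] at this
      omega
    obtain ⟨m1, m2, m3⟩ := Nat.sSup_mem hne hbdd
    have hmax : ∀ k ∈ Mset n x i, k ≤ sSup (Mset n x i) := fun k hk => le_csSup hbdd hk
    generalize sSup (Mset n x i) = k at *
    obtain ⟨i', j, d1, d2, d3, rfl, d5⟩ := aux_dec hn k m1
    obtain rfl : i' = i := by rw [← d5, m2]
    obtain ⟨q, rfl⟩ : ∃ q, j = q + 1 := ⟨j - 1, by omega⟩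
    rw [Nat.add_sub_cancel] at *
    have hlt : sig n x ((q + 1) * n + i') < sig n x (q * n + i') := by
      rw [m3]
      refine lt_of_le_of_ne (aux_le hn x hx i' (q + 1) hi1 hin) (fun he => ?_)
      have := hmax _ ⟨by omega, aux_col _ _ hi1 hin, he⟩
      rw [Nat.add_mul] at this
      omega
    have hr := aux_rec hn x hx i' q hi1 hin
    have hc := aux_chain x hx (i' + 1) (q + 1) (by omega) (by omega)
    rw [Nat.add_sub_cancel] at hc
    have hlow : Xc n x (i' - 1) (q + 2) < Xc n x i' (q + 1) := by
      linarith
    refine aux_upd x _ (-1) hx i' q hi1 hin ?_ (fun l => by ring) (by linarith) ?_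
    · by_contra hcon
      rw [aux_Xzero x hx i' (q + 1) (by omega), aux_Xzero x hx (i' - 1) (q + 2) (by omega)] at hlow
      omega
    · intro hq
      have := aux_chain x hx (i' + 1) q (by omega) hq
      rw [Nat.add_sub_cancel] at this
      linarith

end PolyReal
end

section
/- For every x ∈ Σ_ι[λ] there exists a unique reverse semistandard Young tableau T of shape λ with entries in {1, …, n+1} such that Λ_i^{(j)}(T) = Λ_i^{(j)}(x) for all 1 ≤ i ≤ n+1 and all rows j (with Λ_i^{(j)}(x) := 0 when j > n+2−i). Denoting this tableau by ψ_λ(x), the map ψ_λ is a bijection from Σ_ι[λ] onto the set of all reverse semistandard Young tableaux of shape λ with entries in {1, …, n+1}. -/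
namespace PolyReal

theorem count_iff (P : ℕ → Prop) [DecidablePred P] (N : ℕ)
    (h : ∀ c, 1 ≤ c → c + 1 ≤ N → P (c + 1) → P c) (c : ℕ) (hc : 1 ≤ c) :
    c ≤ ((Finset.Icc 1 N).filter P).card ↔ c ≤ N ∧ P c := by
  have down : ∀ d a, 1 ≤ a → a + d ≤ N → P (a + d) → P a := by
    intro d
    induction d with
    | zero => intro a _ _ h3; exact h3
    | succ d ih =>
      intro a h1 h2 h3
      exact ih a h1 (by omega) (h (a + d) (by omega) (by omega) h3)
  constructor
  · intro hle
    by_contra hcon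
    have hsub : (Finset.Icc 1 N).filter P ⊆ Finset.Icc 1 (c - 1) := by
      intro a ha
      simp only [Finset.mem_filter, Finset.mem_Icc] at ha ⊢
      refine ⟨ha.1.1, ?_⟩
      by_contra hlt
      apply hcon
      refine ⟨by omega, ?_⟩
      apply down (a - c) c hc (by omega)
      rw [show c + (a - c) = a by omega]
      exact ha.2
    have := Finset.card_le_card hsub
    simp only [Nat.card_Icc] at this
    omega
  · rintro ⟨h1, h2⟩
    have hsub : Finset.Icc 1 c ⊆ (Finset.Icc 1 N).filter P := by
      intro a ha
      simp only [Finset.mem_filter, Finset.mem_Icc] at ha ⊢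
      refine ⟨⟨ha.1, by omega⟩, ?_⟩
      apply down (c - a) a ha.1 (by omega)
      rw [show a + (c - a) = c by omega]
      exact h2
    have := Finset.card_le_card hsub
    simp only [Nat.card_Icc] at this
    omega

theorem eq_of_nat_le (a b : ℤ) (ha : 0 ≤ a) (hb : 0 ≤ b)
    (h : ∀ c : ℕ, 1 ≤ c → ((c : ℤ) ≤ a ↔ (c : ℤ) ≤ b)) : a = b := by
  lift a to ℕ using ha
  lift b to ℕ using hb
  have h1 := h a
  have h2 := h b
  omega

theorem le_of_nat_le (a b : ℤ) (hb : 0 ≤ b)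
    (h : ∀ c : ℕ, 1 ≤ c → (c : ℤ) ≤ a → (c : ℤ) ≤ b) : a ≤ b := by
  by_contra hlt
  have := h a.toNat (by omega) (by omega)
  omega

theorem lamT_nonneg (lam : ℕ → ℤ) (T : ℕ → ℕ → ℕ) (i j : ℕ) : 0 ≤ LamT lam T i j := by
  unfold LamT; positivity

theorem le_lamT (n : ℕ) (lam : ℕ → ℤ) (T : ℕ → ℕ → ℕ) (hT : IsRSSYT n lam T)
    (i j c : ℕ) (hj : 1 ≤ j) (hjn : j ≤ n) (hc : 1 ≤ c) :
    (c : ℤ) ≤ LamT lam T i j ↔ (c : ℤ) ≤ lam j ∧ i ≤ T j c := by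
  have := count_iff (fun c => i ≤ T j c) (lam j).toNat (by
    intro a h1 h2 h3
    exact le_trans h3 (hT.2.1 j a hj hjn h1 (by omega))) c hc
  unfold LamT LamTN
  rw [Nat.cast_le, this]
  have : c ≤ (lam j).toNat ↔ (c : ℤ) ≤ lam j := by omega
  rw [this]

theorem lam_nonneg (n : ℕ) (lam : ℕ → ℤ) (h : IsShape n lam) :
    ∀ d j, 1 ≤ j → j + d = n + 1 → 0 ≤ lam j := by
  intro d
  induction d with
  | zero => intro j _ h2; rw [show j = n + 1 by omega, h.2]
  | succ d ih =>
    intro j h1 h2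
    exact le_trans (ih (j + 1) (by omega) (by omega)) (h.1 j h1 (by omega))

theorem rssyt_ext (n : ℕ) (lam : ℕ → ℤ) (T T' : ℕ → ℕ → ℕ)
    (hT : IsRSSYT n lam T) (hT' : IsRSSYT n lam T')
    (h : ∀ i j, 1 ≤ i → i ≤ n + 1 → 1 ≤ j → j ≤ n → LamT lam T i j = LamT lam T' i j) :
    T = T' := by
  funext j c
  by_cases hd : 1 ≤ j ∧ j ≤ n ∧ 1 ≤ c ∧ (c : ℤ) ≤ lam j
  · obtain ⟨h1, h2, h3, h4⟩ := hd
    have b1 := hT.1 j c h1 h2 h3 h4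
    have b2 := hT'.1 j c h1 h2 h3 h4
    have e1 := h (T j c) j b1.1 b1.2 h1 h2
    have e2 := h (T' j c) j b2.1 b2.2 h1 h2
    have a1 := (le_lamT n lam T hT (T j c) j c h1 h2 h3).2 ⟨h4, le_rfl⟩
    have a2 := (le_lamT n lam T' hT' (T' j c) j c h1 h2 h3).2 ⟨h4, le_rfl⟩
    rw [e1] at a1
    rw [← e2] at a2
    have := ((le_lamT n lam T' hT' _ j c h1 h2 h3).1 a1).2
    have := ((le_lamT n lam T hT _ j c h1 h2 h3).1 a2).2
    omega
  · rw [hT.2.2.2 j c hd, hT'.2.2.2 j c hd]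

/-- The tableau attached to an array `L`. -/
def tabOf (n : ℕ) (lam : ℕ → ℤ) (L : ℕ → ℕ → ℤ) : ℕ → ℕ → ℕ := fun j c =>
  if 1 ≤ j ∧ j ≤ n ∧ 1 ≤ c ∧ (c : ℤ) ≤ lam j then
    ((Finset.Icc 1 (n + 1)).filter (fun i => (c : ℤ) ≤ L i j)).card
  else 0

theorem tabOf_spec (n : ℕ) (lam : ℕ → ℤ) (L : ℕ → ℕ → ℤ)
    (ha : ∀ j, 1 ≤ j → j ≤ n → L 1 j = lam j)
    (hb : ∀ i j, 1 ≤ i → i ≤ n → 1 ≤ j → j ≤ n → L (i + 1) j ≤ L i j)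
    (hc : ∀ i j, 1 ≤ i → i ≤ n → 1 ≤ j → j + 1 ≤ n → L i (j + 1) ≤ L (i + 1) j)
    (hd : ∀ i j, 1 ≤ i → i ≤ n + 1 → 1 ≤ j → j ≤ n → 0 ≤ L i j)
    (he : ∀ j, 1 ≤ j → j + 1 ≤ n → L (n + 1) (j + 1) = 0)
    (hmono : ∀ i, 1 ≤ i → i ≤ n → lam (i + 1) ≤ lam i) :
    IsRSSYT n lam (tabOf n lam L) ∧
      ∀ i j, 1 ≤ i → i ≤ n + 1 → 1 ≤ j → j ≤ n → LamT lam (tabOf n lam L) i j = L i j := by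
  have key : ∀ i j c : ℕ, 1 ≤ i → 1 ≤ j → j ≤ n → 1 ≤ c → (c : ℤ) ≤ lam j →
      (i ≤ tabOf n lam L j c ↔ i ≤ n + 1 ∧ (c : ℤ) ≤ L i j) := by
    intro i j c h1 h2 h3 h4 h5
    unfold tabOf
    rw [if_pos ⟨h2, h3, h4, h5⟩]
    exact count_iff (fun i => (c : ℤ) ≤ L i j) (n + 1) (by
      intro a g1 g2 g3
      exact le_trans g3 (hb a j g1 (by omega) h2 h3)) i h1
  have hL : ∀ i j, 1 ≤ i → i ≤ n + 1 → 1 ≤ j → j ≤ n → L i j ≤ lam j := by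
    intro i j h1
    induction i, h1 using Nat.le_induction with
    | base => intro _ h3 h4; rw [ha j h3 h4]
    | succ i h1 ih =>
      intro h2 h3 h4
      exact le_trans (hb i j h1 (by omega) h3 h4) (ih (by omega) h3 h4)
  have hR : IsRSSYT n lam (tabOf n lam L) := by
    refine ⟨?_, ?_, ?_, ?_⟩
    · intro j c h1 h2 h3 h4
      have k1 := (key 1 j c le_rfl h1 h2 h3 h4).2 ⟨by omega, by rw [ha j h1 h2]; exact h4⟩
      exact ⟨k1, ((key _ j c k1 h1 h2 h3 h4).1 le_rfl).1⟩
    · intro j c h1 h2 h3 h4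
      by_cases hz : tabOf n lam L j (c + 1) = 0
      · omega
      · have k1 := (key _ j (c + 1) (by omega) h1 h2 (by omega) (by push_cast; exact h4)).1
          (le_refl (tabOf n lam L j (c + 1)))
        refine (key _ j c (by omega) h1 h2 h3 (by omega)).2 ⟨k1.1, ?_⟩
        have := k1.2
        push_cast at this
        omega
    · intro j c h1 h2 h3 h4
      have hm := hmono j h1 (by omega)
      by_cases hz : tabOf n lam L (j + 1) c = 0
      · have := (key 1 j c le_rfl h1 (by omega) h3 (by omega)).2
          ⟨by omega, by rw [ha j h1 (by omega)]; omega⟩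
        omega
      · have k1 := (key _ (j + 1) c (by omega) (by omega) h2 h3 h4).1
          (le_refl (tabOf n lam L (j + 1) c))
        generalize tabOf n lam L (j + 1) c = t at *
        have htn : t ≤ n := by
          by_contra hcon
          have : t = n + 1 := by omega
          subst this
          have := he j h1 h2
          omega
        have := hc t j (by omega) htn h1 h2
        exact (key (t + 1) j c (by omega) h1 (by omega) h3 (by omega)).2 ⟨by omega, by omega⟩
    · intro j c h
      unfold tabOf
      rw [if_neg h]
  refine ⟨hR, ?_⟩
  intro i j h1 h2 h3 h4
  apply eq_of_nat_le _ _ (lamT_nonneg _ _ _ _) (hd i j h1 h2 h3 h4)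
  intro c hc1
  rw [le_lamT n lam _ hR i j c h3 h4 hc1]
  have := hL i j h1 h2 h3 h4
  constructor
  · rintro ⟨g1, g2⟩
    exact ((key i j c h1 h3 h4 hc1 g1).1 g2).2
  · intro g
    have g1 : (c : ℤ) ≤ lam j := by omega
    exact ⟨g1, (key i j c h1 h3 h4 hc1 g1).2 ⟨h2, g⟩⟩

theorem Xc_zero (n : ℕ) (x : ℕ → ℤ) (j : ℕ) : Xc n x 0 j = 0 := by
  simp [Xc]

theorem Xc_nonneg (n : ℕ) (x : ℕ → ℤ) (h : InSigma n x) :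
    ∀ m k, 1 ≤ k → m + k ≤ n + 1 → 0 ≤ Xc n x m k := by
  intro m
  induction m with
  | zero => intro k _ _; rw [Xc_zero]
  | succ m ih =>
    intro k h1 h2
    have := h.2.1 (m + k) k (by omega) (by omega) h1 (by omega)
    rw [show m + k - k = m by omega, show m + k + 1 - k = m + 1 by omega] at this
    exact le_trans (ih (k + 1) (by omega) (by omega)) this

theorem tab_of_x (n : ℕ) (lam : ℕ → ℤ) (hlam : IsShape n lam) (x : ℕ → ℤ)
    (hx : InSigmaL n lam x) :
    IsRSSYT n lam (tabOf n lam (Lam n lam x)) ∧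
      ∀ i j, 1 ≤ i → i ≤ n + 1 → 1 ≤ j → j ≤ n →
        LamT lam (tabOf n lam (Lam n lam x)) i j = Lam n lam x i j := by
  have hnn : ∀ i j, 1 ≤ i → i ≤ n + 1 → 1 ≤ j → 0 ≤ Lam n lam x i j := by
    intro i j h1 h2 h3
    unfold Lam
    split_ifs with h
    · have g1 := Xc_nonneg n x hx.1 (i - 1) j h3 (by omega)
      have g2 := lam_nonneg n lam hlam (n + 1 - (j + i - 1)) (j + i - 1) (by omega) (by omega)
      omega
    · exact le_rfl
  apply tabOf_spec
  · intro j h1 h2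
    unfold Lam
    rw [if_pos ⟨h1, by omega⟩, Xc_zero]
    simp
  · intro i j h1 h2 h3 h4
    by_cases hj : j ≤ n + 2 - (i + 1)
    · unfold Lam
      rw [if_pos ⟨h3, hj⟩, if_pos ⟨h3, by omega⟩]
      have := hx.2 (i + j - 1) j h3 (by omega) (by omega)
      rw [show i + j - 1 - j + 1 = i by omega, show i + j - 1 - j = i - 1 by omega,
        show i + j - 1 + 1 = i + j by omega] at this
      rw [show i + 1 - 1 = i by omega, show j + (i + 1) - 1 = i + j by omega,
        show j + i - 1 = i + j - 1 by omega]
      omega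
    · have := hnn i j h1 (by omega) h3
      have e : Lam n lam x (i + 1) j = 0 := by
        unfold Lam; rw [if_neg (fun h => hj h.2)]
      omega
  · intro i j h1 h2 h3 h4
    by_cases hj : j + 1 ≤ n + 2 - i
    · unfold Lam
      rw [if_pos ⟨by omega, hj⟩, if_pos ⟨h3, by omega⟩]
      have := hx.1.2.1 (i + j - 1) j (by omega) (by omega) h3 (by omega)
      rw [show i + j - 1 - j = i - 1 by omega, show i + j - 1 + 1 - j = i by omega] at this
      rw [show i + 1 - 1 = i by omega, show j + (i + 1) - 1 = i + j by omega,
        show j + 1 + i - 1 = i + j by omega]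
      omega
    · have := hnn (i + 1) j (by omega) (by omega) h3
      have e : Lam n lam x i (j + 1) = 0 := by
        unfold Lam; rw [if_neg (fun h => hj h.2)]
      omega
  · intro i j h1 h2 h3 _
    exact hnn i j h1 h2 h3
  · intro j h1 _
    unfold Lam
    rw [if_neg (by omega)]
  · exact hlam.1

theorem Xc_varsig (n : ℕ) (lam : ℕ → ℤ) (g : ℕ → ℕ → ℤ) (i j : ℕ)
    (h1 : 1 ≤ i) (h2 : i ≤ n) (h3 : 1 ≤ j) :
    Xc n (varsig n lam g) i j = if i + j ≤ n + 1 then g i j - lam (i + j) else 0 := by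
  unfold Xc
  rw [if_pos ⟨h1, h2, h3⟩]
  unfold varsig
  rw [if_neg (by omega)]
  have e : (j - 1) * n + i - 1 = (i - 1) + n * (j - 1) := by
    rw [mul_comm]; omega
  have e1 : ((j - 1) * n + i - 1) % n + 1 = i := by
    rw [e, Nat.add_mul_mod_self_left, Nat.mod_eq_of_lt (by omega)]; omega
  have e2 : ((j - 1) * n + i - 1) / n + 1 = j := by
    rw [e, Nat.add_mul_div_left _ _ (by omega), Nat.div_eq_of_lt (by omega)]; omega
  rw [e1, e2]

theorem x_ext (n : ℕ) (hn : 1 ≤ n) (x y : ℕ → ℤ) (h0 : x 0 = y 0)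
    (h : ∀ i j, 1 ≤ i → i ≤ n → 1 ≤ j → Xc n x i j = Xc n y i j) : x = y := by
  funext p
  by_cases hp : p = 0
  · rw [hp, h0]
  · have hm := Nat.mod_lt (p - 1) (show n > 0 by omega)
    have := h ((p - 1) % n + 1) ((p - 1) / n + 1) (by omega) (by omega)
      (Nat.le_add_left 1 _)
    unfold Xc at this
    rw [if_pos ⟨by omega, by omega, Nat.le_add_left 1 _⟩,
      if_pos ⟨by omega, by omega, Nat.le_add_left 1 _⟩] at this
    have e : ((p - 1) / n + 1 - 1) * n + ((p - 1) % n + 1) = p := by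
      have := Nat.div_add_mod (p - 1) n
      rw [Nat.add_sub_cancel, mul_comm]; omega
    rwa [e] at this

theorem entry_le (n : ℕ) (lam : ℕ → ℤ) (hlam : IsShape n lam) (T : ℕ → ℕ → ℕ)
    (hT : IsRSSYT n lam T) (j : ℕ) (h1 : 1 ≤ j) :
    ∀ c : ℕ, j ≤ n → 1 ≤ c → (c : ℤ) ≤ lam j → T j c + j ≤ n + 2 := by
  induction j, h1 using Nat.le_induction with
  | base => intro c h2 h3 h4; have := hT.1 1 c le_rfl h2 h3 h4; omega
  | succ j h1 ih =>
    intro c h2 h3 h4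
    have g1 := ih c (by omega) h3 (le_trans h4 (hlam.1 j h1 (by omega)))
    have g2 := hT.2.2.1 j c h1 h2 h3 h4
    omega

theorem surj_aux (n : ℕ) (lam : ℕ → ℤ) (hlam : IsShape n lam) (T : ℕ → ℕ → ℕ)
    (hT : IsRSSYT n lam T) :
    ∃ x, InSigmaL n lam x ∧ ∀ i j, 1 ≤ i → i ≤ n + 1 → 1 ≤ j → j ≤ n →
      LamT lam T i j = Lam n lam x i j := by
  have hone : ∀ j, 1 ≤ j → j ≤ n → LamT lam T 1 j = lam j := by
    intro j h1 h2
    apply eq_of_nat_le _ _ (lamT_nonneg _ _ _ _)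
      (lam_nonneg n lam hlam (n + 1 - j) j h1 (by omega))
    intro c hc
    rw [le_lamT n lam T hT 1 j c h1 h2 hc]
    exact ⟨fun h => h.1, fun h => ⟨h, (hT.1 j c h1 h2 hc h).1⟩⟩
  have hb : ∀ i j, 1 ≤ j → j ≤ n → LamT lam T (i + 1) j ≤ LamT lam T i j := by
    intro i j h1 h2
    apply le_of_nat_le _ _ (lamT_nonneg _ _ _ _)
    intro c hc
    rw [le_lamT n lam T hT _ j c h1 h2 hc, le_lamT n lam T hT _ j c h1 h2 hc]
    rintro ⟨a, b⟩
    exact ⟨a, by omega⟩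
  have hc : ∀ i j, 1 ≤ j → j + 1 ≤ n → LamT lam T i (j + 1) ≤ LamT lam T (i + 1) j := by
    intro i j h1 h2
    apply le_of_nat_le _ _ (lamT_nonneg _ _ _ _)
    intro c hc
    rw [le_lamT n lam T hT _ _ c (by omega) h2 hc, le_lamT n lam T hT _ j c h1 (by omega) hc]
    rintro ⟨a, b⟩
    have := hT.2.2.1 j c h1 h2 hc a
    exact ⟨le_trans a (hlam.1 j h1 (by omega)), by omega⟩
  have hz : ∀ i j, 1 ≤ j → j ≤ n → n + 2 < i + j → LamT lam T i j = 0 := by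
    intro i j h1 h2 h3
    apply eq_of_nat_le _ _ (lamT_nonneg _ _ _ _) le_rfl
    intro c hc
    rw [le_lamT n lam T hT _ j c h1 h2 hc]
    constructor
    · rintro ⟨a, b⟩
      have := entry_le n lam hlam T hT j h1 c h2 hc a
      omega
    · intro h; omega
  -- the values of `x + λ`
  set x := varsig n lam (fun m k => LamT lam T (m + 1) k) with hxdef
  have hX : ∀ m k, 1 ≤ k → k ≤ n → m + k ≤ n + 1 →
      Xc n x m k = LamT lam T (m + 1) k - lam (m + k) := by
    intro m k h1 h2 h3
    by_cases hm : m = 0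
    · subst hm
      rw [Xc_zero, Nat.zero_add, Nat.zero_add, hone k h1 h2]; omega
    · rw [hxdef, Xc_varsig n lam _ m k (by omega) (by omega) h1, if_pos h3]
  refine ⟨x, ⟨⟨?_, ?_, ?_⟩, ?_⟩, ?_⟩
  · simp [hxdef, varsig]
  · intro i k h1 h2 h3 h4
    rw [hX (i + 1 - k) k h3 (by omega) (by omega)]
    rw [show i + 1 - k + k = i + 1 by omega]
    by_cases hk : k + 1 ≤ n
    · rw [hX (i - k) (k + 1) (by omega) hk (by omega), show i - k + (k + 1) = i + 1 by omega]
      have := hc (i - k + 1) k h3 hk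
      rw [show i + 1 - k + 1 = i - k + 1 + 1 by omega]
      omega
    · have : i = n := by omega
      subst this
      rw [show i - k = 0 by omega, Xc_zero, hlam.2]
      have := lamT_nonneg lam T (i + 1 - k + 1) k
      omega
  · intro i j h1 h2 h3 h4
    rw [hxdef, Xc_varsig n lam _ i j h1 h2 h3, if_neg (by omega)]
  · intro i j h1 h2 h3
    rw [hX _ j h1 (by omega) (by omega), hX _ j h1 (by omega) (by omega),
      show i - j + 1 + j = i + 1 by omega, show i - j + j = i by omega]
    have := hb (i - j + 1) j h1 (by omega)
    omega
  · intro i j h1 h2 h3 h4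
    unfold Lam
    split_ifs with h
    · rw [hX _ j h3 h4 (by omega), show i - 1 + 1 = i by omega,
        show i - 1 + j = j + i - 1 by omega]
      omega
    · exact hz i j h3 h4 (by omega)

/-- for every `x ∈ Σ_ι[λ]` there is a unique RSSYT `T` of shape `λ`
with entries in `{1, …, n+1}` such that `Λ_i^{(j)}(T) = Λ_i^{(j)}(x)` for all
`1 ≤ i ≤ n+1` and all rows `1 ≤ j ≤ n`; the resulting map `ψ_λ` is a bijection
from `Σ_ι[λ]` onto the set of all such RSSYT. -/
theorem stmt4 (n : ℕ) (hn : 1 ≤ n) (lam : ℕ → ℤ) (hlam : IsShape n lam) :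
    (∀ x : ℕ → ℤ, InSigmaL n lam x →
      ∃! T : ℕ → ℕ → ℕ, IsRSSYT n lam T ∧
        ∀ i j, 1 ≤ i → i ≤ n + 1 → 1 ≤ j → j ≤ n →
          LamT lam T i j = Lam n lam x i j) ∧
    ∃ ψ : (ℕ → ℤ) → (ℕ → ℕ → ℕ),
      (∀ x : ℕ → ℤ, InSigmaL n lam x →
        IsRSSYT n lam (ψ x) ∧
        ∀ i j, 1 ≤ i → i ≤ n + 1 → 1 ≤ j → j ≤ n →
          LamT lam (ψ x) i j = Lam n lam x i j) ∧
      Set.BijOn ψ {x | InSigmaL n lam x} {T | IsRSSYT n lam T} := by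
  have huniq : ∀ x T, InSigmaL n lam x → IsRSSYT n lam T →
      (∀ i j, 1 ≤ i → i ≤ n + 1 → 1 ≤ j → j ≤ n → LamT lam T i j = Lam n lam x i j) →
      T = tabOf n lam (Lam n lam x) := by
    intro x T hx hT h
    have := tab_of_x n lam hlam x hx
    apply rssyt_ext n lam _ _ hT this.1
    intro i j h1 h2 h3 h4
    rw [h i j h1 h2 h3 h4, this.2 i j h1 h2 h3 h4]
  refine ⟨?_, fun x => tabOf n lam (Lam n lam x), ?_, ?_, ?_, ?_⟩
  · intro x hx
    exact ⟨_, tab_of_x n lam hlam x hx, fun T hT => huniq x T hx hT.1 hT.2⟩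
  · intro x hx
    exact tab_of_x n lam hlam x hx
  · intro x hx
    exact (tab_of_x n lam hlam x hx).1
  · intro x hx y hy hxy
    replace hx : InSigmaL n lam x := hx
    replace hy : InSigmaL n lam y := hy
    apply x_ext n hn x y (by rw [hx.1.1, hy.1.1])
    intro i j h1 h2 h3
    by_cases hij : i + j ≤ n + 1
    · have e1 := (tab_of_x n lam hlam x hx).2 (i + 1) j (by omega) (by omega) h3 (by omega)
      have e2 := (tab_of_x n lam hlam y hy).2 (i + 1) j (by omega) (by omega) h3 (by omega)
      have hxy' : tabOf n lam (Lam n lam x) = tabOf n lam (Lam n lam y) := hxy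
      rw [hxy', e2] at e1
      unfold Lam at e1
      rw [if_pos ⟨h3, by omega⟩, if_pos ⟨h3, by omega⟩, show i + 1 - 1 = i by omega] at e1
      omega
    · rw [hx.1.2.2 i j h1 h2 h3 (by omega), hy.1.2.2 i j h1 h2 h3 (by omega)]
  · intro T hT
    obtain ⟨x, hx, h⟩ := surj_aux n lam hlam T hT
    exact ⟨x, hx, (huniq x T hx hT h).symm⟩

end PolyReal
end

section
/- Let x ∈ Σ_ι[λ] and let T = ψ_λ(x) be the unique RSSYT of shape λ with entries in {1, …, n+1} satisfying Λ_i^{(j)}(T) = Λ_i^{(j)}(x) for all i, j. Then for every 1 ≤ i ≤ n+1 the number of boxes of T containing the entry i equals λ_i + Σ_{j=1}^{n+2−i} x_j^{(i−1)} − Σ_{j=1}^{n+1−i} x_j^{(i)}, with the conventions x_j^{(0)} := 0, x_j^{(n+1)} := 0 and λ_{n+1} := 0. -/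
namespace PolyReal

theorem sum_Lam_aux (n : ℕ) (lam : ℕ → ℤ) (hlam : lam (n + 1) = 0) (x : ℕ → ℤ) (i : ℕ)
    (hi1 : 1 ≤ i) :
    ∑ j ∈ Finset.Icc 1 n, Lam n lam x i j =
      ∑ j ∈ Finset.Icc 1 (n + 2 - i), (Xc n x (i - 1) j + lam (j + i - 1)) := by
  have h0 : Lam n lam x i (n + 1) = 0 := by
    unfold Lam
    split_ifs with h
    · have : i = 1 := by omega
      subst this
      simp [Xc, hlam]
    · rfl
  have h1 : ∑ j ∈ Finset.Icc 1 n, Lam n lam x i j =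
      ∑ j ∈ Finset.Icc 1 (n + 1), Lam n lam x i j := by
    rw [Finset.sum_Icc_succ_top (by omega), h0, add_zero]
  rw [h1]
  symm
  have h2 : ∀ j ∈ Finset.Icc 1 (n + 2 - i),
      Xc n x (i - 1) j + lam (j + i - 1) = Lam n lam x i j := by
    intro j hj
    rw [Finset.mem_Icc] at hj
    unfold Lam
    rw [if_pos hj]
  rw [Finset.sum_congr rfl h2]
  apply Finset.sum_subset
  · intro j hj
    rw [Finset.mem_Icc] at *
    omega
  · intro j _ hj
    rw [Finset.mem_Icc] at hj
    unfold Lam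
    rw [if_neg hj]

theorem sum_shift_aux (f : ℕ → ℤ) (m : ℕ) :
    ∑ j ∈ Finset.Icc 1 (m + 1), f j = f 1 + ∑ j ∈ Finset.Icc 1 m, f (j + 1) := by
  induction m with
  | zero => simp
  | succ k ih =>
    rw [Finset.sum_Icc_succ_top (by omega), ih, Finset.sum_Icc_succ_top (by omega)]
    ring

/-- for `x ∈ Σ_ι[λ]` and `T = ψ_λ(x)` (the unique RSSYT with
`Λ_i^{(j)}(T) = Λ_i^{(j)}(x)` for all `i, j`), the number of boxes of `T`
containing the entry `i` equals
`λ_i + Σ_{j=1}^{n+2-i} x_j^{(i-1)} - Σ_{j=1}^{n+1-i} x_j^{(i)}`. -/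
theorem stmt5 (n : ℕ) (hn : 1 ≤ n) (lam : ℕ → ℤ) (hlam : IsShape n lam)
    (x : ℕ → ℤ) (hx : InSigmaL n lam x)
    (T : ℕ → ℕ → ℕ) (hT : IsRSSYT n lam T)
    (hmatch : ∀ i j, 1 ≤ i → i ≤ n + 1 → 1 ≤ j → j ≤ n →
      LamT lam T i j = Lam n lam x i j)
    (i : ℕ) (hi1 : 1 ≤ i) (hi : i ≤ n + 1) :
    countEntry n lam T i =
      lam i + ∑ j ∈ Finset.Icc 1 (n + 2 - i), Xc n x (i - 1) j
        - ∑ j ∈ Finset.Icc 1 (n + 1 - i), Xc n x i j := by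
  have hm2 : ∀ j ∈ Finset.Icc 1 n, LamT lam T (i + 1) j = Lam n lam x (i + 1) j := by
    intro j hj
    rw [Finset.mem_Icc] at hj
    by_cases h : i ≤ n
    · exact hmatch _ _ (by omega) (by omega) hj.1 hj.2
    · have h3 : Lam n lam x (i + 1) j = 0 := by
        unfold Lam
        rw [if_neg (by omega)]
      rw [h3]
      unfold LamT LamTN
      rw [Nat.cast_eq_zero, Finset.card_eq_zero, Finset.filter_eq_empty_iff]
      intro c hc
      rw [Finset.mem_Icc] at hc
      have := (hT.1 j c hj.1 hj.2 hc.1 (by omega)).2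
      omega
  have hc : countEntry n lam T i =
      ∑ j ∈ Finset.Icc 1 n, Lam n lam x i j - ∑ j ∈ Finset.Icc 1 n, Lam n lam x (i + 1) j := by
    rw [← Finset.sum_sub_distrib]
    unfold countEntry
    apply Finset.sum_congr rfl
    intro j hj
    rw [← hm2 j hj]
    rw [Finset.mem_Icc] at hj
    rw [← hmatch i j hi1 hi hj.1 hj.2]
    unfold LamT LamTN
    rw [eq_sub_iff_add_eq, ← Nat.cast_add, ← Finset.card_union_of_disjoint]
    · congr 2
      ext c
      simp only [Finset.mem_union, Finset.mem_filter]
      grind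
    · rw [Finset.disjoint_filter]
      intro c _ _
      omega
  rw [hc, sum_Lam_aux n lam hlam.2 x i hi1, sum_Lam_aux n lam hlam.2 x (i + 1) (by omega),
    Finset.sum_add_distrib, Finset.sum_add_distrib]
  obtain ⟨m, hm⟩ : ∃ m, m = n + 1 - i := ⟨_, rfl⟩
  have e1 : n + 2 - i = m + 1 := by omega
  have e2 : n + 2 - (i + 1) = m := by omega
  have e3 : 1 + i - 1 = i := by omega
  rw [e2, ← hm, e1, sum_shift_aux (fun j => lam (j + i - 1)) m]
  have e4 : ∀ j ∈ Finset.Icc 1 m, lam (j + 1 + i - 1) = lam (j + (i + 1) - 1) := by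
    intro j _
    congr 1
    omega
  simp only [e3, Finset.sum_congr rfl e4, Nat.add_sub_cancel]
  ring

end PolyReal
end

section
/- Let x ∈ Σ_ι[λ]. Then for every 1 ≤ i ≤ n, σ^{(i)}(x) = max_{j ≥ 1} { x_j^{(i)} − x_j^{(i+1)} + 2 Σ_{k=j+1}^{n+1−i} x_k^{(i)} − Σ_{k=j+1}^{n+2−i} x_k^{(i−1)} − Σ_{k=j+1}^{n−i} x_k^{(i+1)} }, with the conventions x_k^{(0)} := 0 and x_k^{(n+1)} := 0; moreover this maximum is attained for some 1 ≤ j ≤ n+1−i. -/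
namespace PolyReal

theorem block_sum (n : ℕ) (x : ℕ → ℤ) (i q s : ℕ) (hi1 : 1 ≤ i) (hin : i ≤ n) (hs : s ≤ n) :
    ∑ l ∈ Finset.Ioc (q * n + s) (q * n + n), coef i (col n l) * x l =
      (if s < i then 2 * Xc n x i (q + 1) else 0) - (if s + 1 < i then Xc n x (i - 1) (q + 1) else 0)
        - (if s < i + 1 then Xc n x (i + 1) (q + 1) else 0) := by
  have h1 : ∑ l ∈ Finset.Ioc (q * n + s) (q * n + n), coef i (col n l) * x l
      = ∑ c ∈ Finset.Ioc s n, coef i (col n (q * n + c)) * x (q * n + c) := by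
    have : Finset.Ioc (q * n + s) (q * n + n) = (Finset.Ioc s n).image (fun c => q * n + c) := by
      simp
    rw [this, Finset.sum_image (by intro a _ b _ h; simpa using h)]
  rw [h1]
  have h2 : ∀ c ∈ Finset.Ioc s n, coef i (col n (q * n + c)) * x (q * n + c)
      = (if c = i then 2 * Xc n x i (q + 1) else 0) - (if c = i - 1 then Xc n x (i - 1) (q + 1) else 0)
        - (if c = i + 1 then Xc n x (i + 1) (q + 1) else 0) := by
    intro c hc
    rw [Finset.mem_Ioc] at hc
    have hcol : col n (q * n + c) = c := by
      unfold col
      have : q * n + c - 1 = (c - 1) + n * q := by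
        rw [mul_comm]; omega
      rw [this, Nat.add_mul_mod_self_left, Nat.mod_eq_of_lt (by omega)]
      omega
    have hX : x (q * n + c) = Xc n x c (q + 1) := by
      unfold Xc
      rw [if_pos ⟨by omega, by omega, by omega⟩]; simp
    rw [hcol, hX]
    unfold coef
    split_ifs <;> first | omega | (subst_vars; simp; done) | (exfalso; omega)
  rw [Finset.sum_congr rfl h2, Finset.sum_sub_distrib, Finset.sum_sub_distrib,
    Finset.sum_ite_eq', Finset.sum_ite_eq', Finset.sum_ite_eq']
  simp only [Finset.mem_Ioc]
  have e3 : (if s < i + 1 ∧ i + 1 ≤ n then Xc n x (i + 1) (q + 1) else 0)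
      = (if s < i + 1 then Xc n x (i + 1) (q + 1) else 0) := by
    by_cases h : i + 1 ≤ n
    · simp [h]
    · simp [Xc, h]
  rw [e3]
  congr 2
  · simp [hin]
  · congr 1
    apply propext; omega

theorem tail_sum (n : ℕ) (x : ℕ → ℤ) (i : ℕ) (hi1 : 1 ≤ i) (hin : i ≤ n) (d : ℕ) : ∀ q : ℕ,
    q + d = n + 1 →
    ∑ l ∈ Finset.Ioc (q * n) (n * n + n), coef i (col n l) * x l =
      ∑ k ∈ Finset.Icc (q + 1) (n + 1),
        (2 * Xc n x i k - Xc n x (i - 1) k - Xc n x (i + 1) k) := by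
  induction d with
  | zero =>
    intro q hq
    have : q = n + 1 := by omega
    subst this
    rw [Finset.Ioc_eq_empty (by rw [not_lt]; nlinarith), Finset.Icc_eq_empty (by omega)]
    simp
  | succ d ih =>
    intro q hq
    have hb := block_sum n x i q 0 hi1 hin (by omega)
    have e2 : (if 0 + 1 < i then Xc n x (i - 1) (q + 1) else 0) = Xc n x (i - 1) (q + 1) := by
      split_ifs with h
      · rfl
      · have : i - 1 = 0 := by omega
        simp [Xc, this]
    rw [e2, if_pos (by omega), if_pos (by omega), add_zero] at hb
    have hle : q * n + n ≤ n * n + n := by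
      have : q * n ≤ n * n := Nat.mul_le_mul_right _ (by omega)
      omega
    rw [← Finset.sum_Ioc_consecutive _ (by omega : q * n ≤ q * n + n) hle, hb]
    have := ih (q + 1) (by omega)
    rw [show (q + 1) * n = q * n + n by ring] at this
    rw [this, ← Finset.add_sum_Ioc_eq_sum_Icc (a := q + 1) (b := n + 1) (by omega)]
    rw [show Finset.Icc (q + 1 + 1) (n + 1) = Finset.Ioc (q + 1) (n + 1) by
      ext a; simp only [Finset.mem_Icc, Finset.mem_Ioc]; omega]

theorem sum_trunc (f : ℕ → ℤ) (a b c : ℕ) (hbc : b ≤ c) (h : ∀ k, a ≤ k → b < k → f k = 0) :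
    ∑ k ∈ Finset.Icc a b, f k = ∑ k ∈ Finset.Icc a c, f k := by
  apply Finset.sum_subset
  · exact Finset.Icc_subset_Icc_right hbc
  · intro k hk hk'
    rw [Finset.mem_Icc] at hk hk'
    exact h k hk.1 (by omega)

theorem sig_eq_s7 (n : ℕ) (x : ℕ → ℤ) (hx : InSigma n x) (i : ℕ) (hi1 : 1 ≤ i) (hin : i ≤ n)
    (j : ℕ) (hj : 1 ≤ j) (hjn : j ≤ n + 1) :
    sig n x ((j - 1) * n + i) = sigExpr n x i j := by
  obtain ⟨q, rfl⟩ : ∃ q, j = q + 1 := ⟨j - 1, by omega⟩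
  have hz : ∀ a k, 1 ≤ k → n + 1 < a + k → Xc n x a k = 0 := by
    intro a k hk h
    by_cases ha : 1 ≤ a ∧ a ≤ n
    · exact hx.2.2 a k ha.1 ha.2 hk h
    · unfold Xc; rw [if_neg (by omega)]
  unfold sig sigExpr
  simp only [Nat.add_sub_cancel]
  have hcol : col n (q * n + i) = i := by
    unfold col
    have : q * n + i - 1 = (i - 1) + n * q := by
      rw [mul_comm]; omega
    rw [this, Nat.add_mul_mod_self_left, Nat.mod_eq_of_lt (by omega)]
    omega
  have hle : q * n + n ≤ n * n + n := by
    have : q * n ≤ n * n := Nat.mul_le_mul_right _ (by omega)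
    omega
  have hX : x (q * n + i) = Xc n x i (q + 1) := by
    unfold Xc
    rw [if_pos ⟨by omega, by omega, by omega⟩]; simp
  have ht := tail_sum n x i hi1 hin (n - q) (q + 1) (by omega)
  rw [show (q + 1) * n = q * n + n by ring] at ht
  rw [hcol, ← Finset.sum_Ioc_consecutive _ (by omega : q * n + i ≤ q * n + n) hle,
    block_sum n x i q i hi1 hin hin, ht, hX, if_neg (by omega), if_neg (by omega),
    if_pos (by omega), Finset.sum_sub_distrib, Finset.sum_sub_distrib, ← Finset.mul_sum,
    sum_trunc (Xc n x i) _ (n + 1 - i) (n + 1) (by omega) (fun k h1 h2 => hz _ _ (by omega) (by omega)),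
    sum_trunc (Xc n x (i - 1)) _ (n + 2 - i) (n + 1) (by omega) (fun k h1 h2 => hz _ _ (by omega) (by omega)),
    sum_trunc (Xc n x (i + 1)) _ (n - i) (n + 1) (by omega) (fun k h1 h2 => hz _ _ (by omega) (by omega))]
  ring

theorem sigExpr_large (n : ℕ) (x : ℕ → ℤ) (hx : InSigma n x) (i : ℕ) (hi1 : 1 ≤ i) (hin : i ≤ n)
    (j : ℕ) (hj : n + 1 - i < j) : sigExpr n x i j = 0 := by
  have hz : ∀ a k, 1 ≤ k → n + 1 < a + k → Xc n x a k = 0 := by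
    intro a k hk h
    by_cases ha : 1 ≤ a ∧ a ≤ n
    · exact hx.2.2 a k ha.1 ha.2 hk h
    · unfold Xc; rw [if_neg (by omega)]
  unfold sigExpr
  rw [hz i j (by omega) (by omega), hz (i + 1) j (by omega) (by omega),
    Finset.Icc_eq_empty (by omega), Finset.Icc_eq_empty (by omega), Finset.Icc_eq_empty (by omega)]
  simp

theorem sigExpr_last (n : ℕ) (x : ℕ → ℤ) (hx : InSigma n x) (i : ℕ) (hi1 : 1 ≤ i) (hin : i ≤ n) :
    0 ≤ sigExpr n x i (n + 1 - i) := by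
  have h0 : Xc n x (i + 1) (n + 1 - i) = 0 := by
    by_cases ha : i + 1 ≤ n
    · exact hx.2.2 _ _ (by omega) ha (by omega) (by omega)
    · unfold Xc; rw [if_neg (by omega)]
  have h := hx.2.1 n (n + 1 - i) (by omega) le_rfl (by omega) (by omega)
  rw [show n - (n + 1 - i) = i - 1 by omega, show n + 1 - (n + 1 - i) = i by omega] at h
  unfold sigExpr
  rw [h0, Finset.Icc_eq_empty (show ¬ n + 1 - i + 1 ≤ n + 1 - i by omega),
    Finset.Icc_eq_empty (show ¬ n + 1 - i + 1 ≤ n - i by omega),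
    show n + 2 - i = n + 1 - i + 1 by omega, Finset.Icc_self]
  simp only [Finset.sum_empty, Finset.sum_singleton]
  linarith

/-- Lemma `lem:sigmaixvalue`: for `x ∈ Σ_ι[λ]` and `1 ≤ i ≤ n`,
`σ^{(i)}(x) = max_{j ≥ 1} { x_j^{(i)} - x_j^{(i+1)} + 2 Σ_{k=j+1}^{n+1-i} x_k^{(i)}
- Σ_{k=j+1}^{n+2-i} x_k^{(i-1)} - Σ_{k=j+1}^{n-i} x_k^{(i+1)} }`, the maximum being
attained for some `1 ≤ j ≤ n+1-i`. -/
theorem stmt7 (n : ℕ) (hn : 1 ≤ n) (lam : ℕ → ℤ) (hlam : IsShape n lam)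
    (x : ℕ → ℤ) (hx : InSigmaL n lam x)
    (i : ℕ) (hi1 : 1 ≤ i) (hin : i ≤ n) :
    (∀ j, 1 ≤ j → sigExpr n x i j ≤ sigmaI n x i) ∧
    (∃ j, 1 ≤ j ∧ j ≤ n + 1 - i ∧ sigExpr n x i j = sigmaI n x i) := by
  have hS := hx.1
  have hle : ∀ j, 1 ≤ j → j ≤ n + 1 → sigExpr n x i j ≤ sigmaI n x i := by
    intro j h1 h2
    rw [← sig_eq_s7 n x hS i hi1 hin j h1 h2]
    exact Finset.le_sup' (fun j => sig n x ((j - 1) * n + i)) (Finset.mem_Icc.mpr ⟨h1, h2⟩)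
  have h0 := sigExpr_last n x hS i hi1 hin
  refine ⟨?_, ?_⟩
  · intro j hj
    by_cases h : j ≤ n + 1
    · exact hle j hj h
    · rw [sigExpr_large n x hS i hi1 hin j (by omega)]
      exact h0.trans (hle _ (by omega) (by omega))
  · obtain ⟨j, hj, he⟩ := Finset.exists_mem_eq_sup' (s := Finset.Icc 1 (n + 1))
      (Finset.nonempty_Icc.mpr (by omega)) (fun j => sig n x ((j - 1) * n + i))
    rw [Finset.mem_Icc] at hj
    have he' : sigmaI n x i = sigExpr n x i j := by
      rw [← sig_eq_s7 n x hS i hi1 hin j hj.1 hj.2]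
      exact he
    by_cases h : j ≤ n + 1 - i
    · exact ⟨j, hj.1, h, he'.symm⟩
    · refine ⟨n + 1 - i, by omega, le_rfl, le_antisymm (hle _ (by omega) (by omega)) ?_⟩
      rw [he', sigExpr_large n x hS i hi1 hin j (by omega)]
      exact h0

end PolyReal
end

section
/- For every x ∈ Σ_ι[λ] and every 1 ≤ i ≤ n, σ^{(i)}(x) ≥ σ_0^{(i)}(x). -/
namespace PolyReal

/-- Lemma `lem:sigmaigeqsigma0`: for every `x ∈ Σ_ι[λ]` and
`1 ≤ i ≤ n`, `σ^{(i)}(x) ≥ σ_0^{(i)}(x)`. -/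
theorem stmt8 (n : ℕ) (hn : 1 ≤ n) (lam : ℕ → ℤ) (hlam : IsShape n lam)
    (x : ℕ → ℤ) (hx : InSigmaL n lam x)
    (i : ℕ) (hi1 : 1 ≤ i) (hin : i ≤ n) :
    sigma0 n lam x i ≤ sigmaI n x i := by
  have hle : sig n x ((1 - 1) * n + i) ≤ sigmaI n x i := by
    unfold sigmaI
    exact Finset.le_sup' (fun j => sig n x ((j - 1) * n + i))
      (Finset.mem_Icc.mpr ⟨le_refl 1, by omega⟩)
  refine le_trans ?_ hle
  have e0 : (1 - 1) * n + i = i := by simp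
  rw [e0]
  have hcol : ∀ l, 1 ≤ l → l ≤ n → col n l = l := by
    intro l h1 h2
    unfold col
    rw [Nat.mod_eq_of_lt (by omega)]
    omega
  have h := hx.2 i 1 le_rfl hi1 hin
  have hx0 := hx.1.1
  have hA : Xc n x (i - 1 + 1) 1 = x i := by
    unfold Xc
    rw [if_pos (by omega)]
    congr 1
    simp
    omega
  have hB : Xc n x (i - 1) 1 = x (i - 1) := by
    unfold Xc
    split_ifs with hc
    · congr 1
      simp
    · have : i - 1 = 0 := by omega
      rw [this, hx0]
  rw [hA, hB] at h
  have hN : i ≤ n * n + n := by nlinarith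
  have hI : Finset.Icc 1 (n * n + n) = Finset.Ioc 0 (n * n + n) := by
    ext a
    simp only [Finset.mem_Icc, Finset.mem_Ioc]
    omega
  have hS : ∑ l ∈ Finset.Ioc 0 i, coef i (col n l) * x l = 2 * x i - x (i - 1) := by
    have h1 : ∑ l ∈ Finset.Ioc 0 i, coef i (col n l) * x l
        = ∑ l ∈ Finset.Ioc 0 i,
          ((if l = i then 2 * x i else 0) - (if l = i - 1 then x (i - 1) else 0)) := by
      refine Finset.sum_congr rfl ?_
      intro l hl
      rw [Finset.mem_Ioc] at hl
      rw [hcol l (by omega) (by omega)]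
      unfold coef
      by_cases ha : l = i
      · subst ha
        have : l ≠ l - 1 := by omega
        simp [this]
      · by_cases hb : l = i - 1
        · have h2 : i ≠ l := by omega
          have h3 : i + 1 = l ∨ l + 1 = i := by omega
          rw [if_neg h2, if_pos h3, if_neg ha, if_pos hb, hb]
          ring
        · have h2 : i ≠ l := by omega
          have h3 : ¬ (i + 1 = l ∨ l + 1 = i) := by omega
          rw [if_neg h2, if_neg h3, if_neg ha, if_neg hb]
          ring
    rw [h1, Finset.sum_sub_distrib, Finset.sum_ite_eq', Finset.sum_ite_eq',
      if_pos (Finset.mem_Ioc.mpr ⟨by omega, le_rfl⟩)]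
    split_ifs with hc
    · rfl
    · have : i - 1 = 0 := by
        rw [Finset.mem_Ioc] at hc
        omega
      rw [this, hx0]
  unfold sigma0 sig
  rw [hI, ← Finset.sum_Ioc_consecutive _ (Nat.zero_le i) hN, hS, hcol i hi1 hin]
  linarith

end PolyReal
end
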